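/- Let μ be a finite positive Borel measure on ℝ with Lebesgue decomposition μ = ρ·dx + μ_s with respect to Lebesgue measure, where ρ ∈ L¹(ℝ) is the Radon–Nikodym derivative of the absolutely continuous part and μ_s is the singular part. Let U ⊆ ℝ be open, let δ > 0, and suppose there is a closed set S ⊆ ℝ with μ_s(ℝ \ S) = 0 and |u − s| ≥ δ for all u ∈ U and s ∈ S. Then lim_{ε→0⁺} ∫_U |(∫_ℝ P_H(u − λ, ε) dμ(λ)) − ρ(u)| du = 0; that is, the Poisson convolution of μ converges to ρ in L¹(U) as ε → 0⁺. -/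

import Mathlib

open MeasureTheory Filter Topology

noncomputable section

/-- The Poisson kernel for the upper half-plane. -/
def PoissonH (x y : ℝ) : ℝ := (1 / Real.pi) * y / (x ^ 2 + y ^ 2)

theorem PoissonH_nonneg (x : ℝ) {y : ℝ} (hy : 0 ≤ y) : 0 ≤ PoissonH x y := by
  unfold PoissonH
  have := Real.pi_pos
  positivity

@[fun_prop]
theorem measurable_PoissonH (y : ℝ) : Measurable fun x => PoissonH x y := by
  unfold PoissonH
  fun_prop

theorem norm_PoissonH_le (x : ℝ) {y : ℝ} (hy : 0 < y) : ‖PoissonH x y‖ ≤ 1 / Real.pi / y := by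
  rw [Real.norm_of_nonneg (PoissonH_nonneg x hy.le)]
  unfold PoissonH
  have := Real.pi_pos
  rw [div_le_div_iff₀ (by positivity) hy]
  have : 0 ≤ 1 / Real.pi * x ^ 2 := by positivity
  nlinarith

theorem PoissonH_one (x : ℝ) : PoissonH x 1 = (1 / Real.pi) * (1 + x ^ 2)⁻¹ := by
  unfold PoissonH
  rw [mul_one, one_pow, add_comm (x ^ 2), div_eq_mul_inv]

theorem mul_PoissonH_mul_self (x : ℝ) {y : ℝ} (hy : 0 < y) :
    y * PoissonH (y * x) y = PoissonH x 1 := by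
  unfold PoissonH
  have : x ^ 2 + 1 ≠ 0 := by positivity
  have : (y * x) ^ 2 + y ^ 2 = y ^ 2 * (x ^ 2 + 1) := by ring
  rw [this]
  have := Real.pi_ne_zero
  field_simp

/-- Away from the origin, the Poisson kernel at height `y` is `O(y)` times that at height `1`. -/
theorem PoissonH_le_of_le_abs {x y δ : ℝ} (hy : 0 < y) (hδ : 0 < δ) (hx : δ ≤ |x|) :
    PoissonH x y ≤ y * (1 + 1 / δ ^ 2) * PoissonH x 1 := by
  have hx2 : δ ^ 2 ≤ x ^ 2 := by rw [← sq_abs x]; gcongr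
  have hx0 : 0 < x ^ 2 := lt_of_lt_of_le (by positivity) hx2
  have hpi := Real.pi_pos
  have key : 1 / (x ^ 2 + y ^ 2) ≤ (1 + 1 / δ ^ 2) * (1 / (x ^ 2 + 1)) := by
    rw [mul_one_div, div_le_div_iff₀ (by positivity) (by positivity)]
    have : 1 ≤ 1 / δ ^ 2 * x ^ 2 := by
      rw [one_div_mul_eq_div, one_le_div (by positivity)]
      exact hx2
    have : 0 ≤ (1 + 1 / δ ^ 2) * y ^ 2 := by positivity
    nlinarith
  calc PoissonH x y = (1 / Real.pi * y) * (1 / (x ^ 2 + y ^ 2)) := by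
        unfold PoissonH; rw [mul_one_div]
    _ ≤ (1 / Real.pi * y) * ((1 + 1 / δ ^ 2) * (1 / (x ^ 2 + 1))) := by gcongr
    _ = y * (1 + 1 / δ ^ 2) * PoissonH x 1 := by unfold PoissonH; ring

theorem integrable_PoissonH_one : Integrable fun x => PoissonH x 1 := by
  simp only [PoissonH_one]
  exact integrable_inv_one_add_sq.const_mul _

theorem integral_PoissonH_one : ∫ x, PoissonH x 1 = 1 := by
  simp only [PoissonH_one]
  rw [integral_const_mul, integral_univ_inv_one_add_sq]
  exact one_div_mul_cancel Real.pi_ne_zero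

theorem lintegral_PoissonH_one : ∫⁻ x, ENNReal.ofReal (PoissonH x 1) = 1 := by
  rw [← ofReal_integral_eq_lintegral_ofReal integrable_PoissonH_one
    (ae_of_all _ fun x => PoissonH_nonneg x zero_le_one), integral_PoissonH_one, ENNReal.ofReal_one]

theorem tendsto_lintegral_enorm_translate_sub {f : ℝ → ℝ} (hf : Integrable f) :
    Tendsto (fun t : ℝ => ∫⁻ u, ‖f (u - t) - f u‖ₑ) (𝓝 0) (𝓝 0) := by
  have hf1 : MemLp f 1 := memLp_one_iff_integrable.2 hf
  let g : C(ℝ, C(ℝ, ℝ)) := (ContinuousMap.mk (fun a : ℝ × ℝ => a.2 - a.1) (by fun_prop)).curry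
  have hg : ∀ t, MeasurePreserving (g t) := fun t => measurePreserving_sub_right volume t
  have hc : Continuous fun t => Lp.compMeasurePreserving (g t) (hg t) (hf1.toLp f) :=
    continuous_const.compMeasurePreservingLp g.continuous hg ENNReal.one_ne_top
  have h := tendsto_iff_edist_tendsto_0.1 (hc.tendsto 0)
  refine h.congr fun t => ?_
  rw [Lp.toLp_compMeasurePreserving, Lp.toLp_compMeasurePreserving, Lp.edist_toLp_toLp,
    eLpNorm_one_eq_lintegral_enorm]
  simp [g]

/-- Rescaling the integration variable in the Poisson convolution. -/
theorem integral_PoissonH_mul (f : ℝ → ℝ) (u : ℝ) {ε : ℝ} (hε : 0 < ε) :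
    ∫ l, PoissonH (u - l) ε * f l = ∫ t, PoissonH t 1 * f (u - ε * t) := by
  have h1 : ∫ l, PoissonH (u - l) ε * f l = ∫ t, PoissonH t ε * f (u - t) := by
    rw [← integral_sub_left_eq_self (fun t => PoissonH t ε * f (u - t)) volume u]
    simp
  have h2 := Measure.integral_comp_mul_left (fun t => PoissonH t ε * f (u - t)) ε
  rw [abs_of_pos (inv_pos.2 hε), smul_eq_mul, eq_inv_mul_iff_mul_eq₀ hε.ne',
    ← integral_const_mul] at h2
  rw [h1, ← h2]
  simp_rw [← mul_assoc, mul_PoissonH_mul_self _ hε]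

theorem enorm_integral_PoissonH_mul_sub_le {f : ℝ → ℝ} (hf : Integrable f) (u : ℝ) {ε : ℝ}
    (hε : 0 < ε) :
    ‖(∫ l, PoissonH (u - l) ε * f l) - f u‖ₑ ≤
      ∫⁻ t, ENNReal.ofReal (PoissonH t 1) * ‖f (u - ε * t) - f u‖ₑ := by
  have hi : Integrable fun t => PoissonH t 1 * f (u - ε * t) :=
    ((hf.comp_sub_left u).comp_mul_left' hε.ne').bdd_mul
      (measurable_PoissonH 1).aestronglyMeasurable
      (ae_of_all _ fun x => norm_PoissonH_le x one_pos)
  have hu : f u = ∫ t, PoissonH t 1 * f u := by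
    rw [integral_mul_const, integral_PoissonH_one, one_mul]
  rw [integral_PoissonH_mul f u hε]
  conv_lhs => rw [hu]
  rw [← integral_sub hi (integrable_PoissonH_one.mul_const _)]
  refine (enorm_integral_le_lintegral_enorm _).trans_eq (lintegral_congr fun t => ?_)
  rw [← mul_sub, enorm_mul, Real.enorm_eq_ofReal (PoissonH_nonneg t zero_le_one)]

theorem tendsto_lintegral_enorm_PoissonH_sub_of_measurable {f : ℝ → ℝ} (hfm : Measurable f)
    (hf : Integrable f) :
    Tendsto (fun ε : ℝ => ∫⁻ u, ‖(∫ l, PoissonH (u - l) ε * f l) - f u‖ₑ) (𝓝[>] 0) (𝓝 0) := by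
  have hT := tendsto_lintegral_enorm_translate_sub hf
  set h : ℝ → ENNReal := fun t => ∫⁻ u, ‖f (u - t) - f u‖ₑ
  have hkm : Measurable fun t => ENNReal.ofReal (PoissonH t 1) := by fun_prop
  have hhm : Measurable h := by
    refine Measurable.lintegral_prod_right' (f := fun p : ℝ × ℝ => ‖f (p.2 - p.1) - f p.2‖ₑ) ?_
    fun_prop
  have hhle : ∀ t, h t ≤ 2 * ∫⁻ u, ‖f u‖ₑ := fun t => by
    calc h t ≤ ∫⁻ u, ‖f (u - t)‖ₑ + ‖f u‖ₑ := lintegral_mono fun u => enorm_sub_le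
      _ = 2 * ∫⁻ u, ‖f u‖ₑ := by
        rw [lintegral_add_right _ hfm.enorm,
          lintegral_sub_right_eq_self (fun u => ‖f u‖ₑ) t, two_mul]
  have hlim : Tendsto (fun ε : ℝ => ∫⁻ t, ENNReal.ofReal (PoissonH t 1) * h (ε * t))
      (𝓝[>] 0) (𝓝 0) := by
    have := tendsto_lintegral_filter_of_dominated_convergence (μ := volume) (l := 𝓝[>] (0 : ℝ))
      (F := fun ε t => ENNReal.ofReal (PoissonH t 1) * h (ε * t)) (f := fun _ => 0)
      (fun t => ENNReal.ofReal (PoissonH t 1) * (2 * ∫⁻ u, ‖f u‖ₑ))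
      (Eventually.of_forall fun ε => by fun_prop)
      (Eventually.of_forall fun ε => ae_of_all _ fun t => by gcongr; exact hhle _)
      (by
        rw [lintegral_mul_const _ hkm, lintegral_PoissonH_one, one_mul]
        exact ENNReal.mul_ne_top ENNReal.ofNat_ne_top hf.2.ne)
      (ae_of_all _ fun t => by
        have h0 : Tendsto (fun ε : ℝ => ε * t) (𝓝[>] 0) (𝓝 0) := by
          have : Continuous fun ε : ℝ => ε * t := by fun_prop
          simpa using (this.tendsto 0).mono_left nhdsWithin_le_nhds
        simpa using ENNReal.Tendsto.const_mul (hT.comp h0) (Or.inr ENNReal.ofReal_ne_top))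
    simpa using this
  refine tendsto_of_tendsto_of_tendsto_of_le_of_le' tendsto_const_nhds hlim
    (Eventually.of_forall fun _ => zero_le) ?_
  filter_upwards [self_mem_nhdsWithin] with ε hε
  refine (lintegral_mono fun u => enorm_integral_PoissonH_mul_sub_le hf u hε).trans_eq ?_
  have hm : Measurable fun p : ℝ × ℝ =>
      ENNReal.ofReal (PoissonH p.2 1) * ‖f (p.1 - ε * p.2) - f p.1‖ₑ := by fun_prop
  exact (lintegral_lintegral_swap hm.aemeasurable).trans
    (lintegral_congr fun t => lintegral_const_mul _ (by fun_prop))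

/-- The Poisson integrals of an integrable function converge to it in `L¹`. -/
theorem tendsto_lintegral_enorm_PoissonH_sub {f : ℝ → ℝ} (hf : Integrable f) :
    Tendsto (fun ε : ℝ => ∫⁻ u, ‖(∫ l, PoissonH (u - l) ε * f l) - f u‖ₑ) (𝓝[>] 0) (𝓝 0) := by
  obtain ⟨g, hgm, hfg⟩ := hf.1
  refine (tendsto_lintegral_enorm_PoissonH_sub_of_measurable hgm.measurable
    (hf.congr hfg)).congr fun ε => lintegral_congr_ae ?_
  filter_upwards [hfg] with u hu
  rw [hu]
  congr 2
  refine integral_congr_ae ?_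
  filter_upwards [hfg] with l hl
  rw [hl]

/-- The Poisson integral of a measure has `L¹` norm `O(ε)` at a positive distance from a set
carrying the measure. -/
theorem setLIntegral_enorm_integral_PoissonH_le (ν : Measure ℝ) [SFinite ν] {U S : Set ℝ}
    (hU : MeasurableSet U) (hνS : ν Sᶜ = 0) {δ ε : ℝ} (hδ : 0 < δ) (hε : 0 < ε)
    (hsep : ∀ u ∈ U, ∀ s ∈ S, δ ≤ |u - s|) :
    ∫⁻ u in U, ‖∫ l, PoissonH (u - l) ε ∂ν‖ₑ ≤
      ENNReal.ofReal (ε * (1 + 1 / δ ^ 2)) * ν Set.univ := by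
  set C := ENNReal.ofReal (ε * (1 + 1 / δ ^ 2)) with hC
  have hm : Measurable fun p : ℝ × ℝ => C * ENNReal.ofReal (PoissonH (p.1 - p.2) 1) := by fun_prop
  have hS : ∀ᵐ l ∂ν, l ∈ S := hνS
  calc ∫⁻ u in U, ‖∫ l, PoissonH (u - l) ε ∂ν‖ₑ
      ≤ ∫⁻ u in U, ∫⁻ l, C * ENNReal.ofReal (PoissonH (u - l) 1) ∂ν := by
        refine setLIntegral_mono' hU fun u hu => (enorm_integral_le_lintegral_enorm _).trans ?_
        refine lintegral_mono_ae ?_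
        filter_upwards [hS] with l hl
        rw [Real.enorm_eq_ofReal (PoissonH_nonneg _ hε.le), hC,
          ← ENNReal.ofReal_mul (by positivity)]
        exact ENNReal.ofReal_le_ofReal (PoissonH_le_of_le_abs hε hδ (hsep u hu l hl))
    _ ≤ ∫⁻ u, ∫⁻ l, C * ENNReal.ofReal (PoissonH (u - l) 1) ∂ν := setLIntegral_le_lintegral _ _
    _ = ∫⁻ l, (∫⁻ u, C * ENNReal.ofReal (PoissonH (u - l) 1)) ∂ν :=
        lintegral_lintegral_swap hm.aemeasurable
    _ = C * ν Set.univ := by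
        have : ∀ l : ℝ, ∫⁻ u, C * ENNReal.ofReal (PoissonH (u - l) 1) = C := fun l => by
          rw [lintegral_const_mul _ (by fun_prop),
            lintegral_sub_right_eq_self (fun u => ENNReal.ofReal (PoissonH u 1)) l,
            lintegral_PoissonH_one, mul_one]
        simp_rw [this, lintegral_const]

theorem integrable_PoissonH_sub (ν : Measure ℝ) [IsFiniteMeasure ν] (u : ℝ) {ε : ℝ} (hε : 0 < ε) :
    Integrable (fun l => PoissonH (u - l) ε) ν :=
  .of_bound (Measurable.aestronglyMeasurable (by fun_prop))
    (1 / Real.pi / ε) (ae_of_all _ fun _ => norm_PoissonH_le _ hε)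

theorem stmt14 (μ : Measure ℝ) [IsFiniteMeasure μ]
    (ρ : ℝ → ℝ) (hρint : Integrable ρ) (hρ0 : ∀ x, 0 ≤ ρ x)
    (μs : Measure ℝ) (hsing : μs ⟂ₘ (volume : Measure ℝ))
    (hdecomp : μ = volume.withDensity (fun x => ENNReal.ofReal (ρ x)) + μs)
    (U : Set ℝ) (hU : IsOpen U) (δ : ℝ) (hδ : 0 < δ)
    (S : Set ℝ) (hS : IsClosed S) (hμsS : μs Sᶜ = 0)
    (hsep : ∀ u ∈ U, ∀ s ∈ S, δ ≤ |u - s|) :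
    Tendsto (fun ε : ℝ => ∫ u in U, |(∫ l, PoissonH (u - l) ε ∂μ) - ρ u|)
      (𝓝[>] 0) (𝓝 0) := by
  have hfin : IsFiniteMeasure μs :=
    isFiniteMeasure_of_le μ (hdecomp ▸ Measure.le_add_left le_rfl)
  have hfinac : IsFiniteMeasure (volume.withDensity fun x => ENNReal.ofReal (ρ x)) :=
    isFiniteMeasure_of_le μ (hdecomp ▸ Measure.le_add_right le_rfl)
  have hsplit : ∀ ε > 0, ∀ u, ∫ l, PoissonH (u - l) ε ∂μ =
      (∫ l, PoissonH (u - l) ε * ρ l) + ∫ l, PoissonH (u - l) ε ∂μs := fun ε hε u => by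
    rw [hdecomp, integral_add_measure (integrable_PoissonH_sub _ u hε)
      (integrable_PoissonH_sub _ u hε), integral_withDensity_eq_integral_toReal_smul₀
      hρint.1.aemeasurable.ennreal_ofReal (ae_of_all _ fun _ => ENNReal.ofReal_lt_top)]
    simp_rw [ENNReal.toReal_ofReal (hρ0 _), smul_eq_mul, mul_comm]
  have hsing_lim : Tendsto (fun ε : ℝ => ENNReal.ofReal (ε * (1 + 1 / δ ^ 2)) * μs Set.univ)
      (𝓝[>] 0) (𝓝 0) := by
    have h0 : Tendsto (fun ε : ℝ => ENNReal.ofReal (ε * (1 + 1 / δ ^ 2))) (𝓝[>] 0) (𝓝 0) := by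
      have : Continuous fun ε : ℝ => ENNReal.ofReal (ε * (1 + 1 / δ ^ 2)) :=
        ENNReal.continuous_ofReal.comp (by fun_prop)
      simpa using (this.tendsto 0).mono_left nhdsWithin_le_nhds
    simpa using ENNReal.Tendsto.mul_const h0 (Or.inr (measure_ne_top μs Set.univ))
  rw [tendsto_zero_iff_enorm_tendsto_zero]
  have hlim := (tendsto_lintegral_enorm_PoissonH_sub hρint).add hsing_lim
  rw [add_zero] at hlim
  refine tendsto_of_tendsto_of_tendsto_of_le_of_le' tendsto_const_nhds hlim
    (Eventually.of_forall fun _ => zero_le) ?_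
  filter_upwards [self_mem_nhdsWithin] with ε hε
  have hmeas : AEMeasurable (fun u => ‖∫ l, PoissonH (u - l) ε ∂μs‖ₑ) (volume.restrict U) := by
    have hm : StronglyMeasurable (fun p : ℝ × ℝ => PoissonH (p.1 - p.2) ε) :=
      Measurable.stronglyMeasurable (by fun_prop)
    exact hm.integral_prod_right'.measurable.enorm.aemeasurable
  calc ‖∫ u in U, |(∫ l, PoissonH (u - l) ε ∂μ) - ρ u|‖ₑ
      ≤ ∫⁻ u in U, ‖|(∫ l, PoissonH (u - l) ε ∂μ) - ρ u|‖ₑ := enorm_integral_le_lintegral_enorm _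
    _ ≤ ∫⁻ u in U, ‖(∫ l, PoissonH (u - l) ε * ρ l) - ρ u‖ₑ +
          ‖∫ l, PoissonH (u - l) ε ∂μs‖ₑ := lintegral_mono fun u => by
        rw [Real.enorm_abs, hsplit ε hε u, add_sub_right_comm]
        exact enorm_add_le _ _
    _ = (∫⁻ u in U, ‖(∫ l, PoissonH (u - l) ε * ρ l) - ρ u‖ₑ) +
          ∫⁻ u in U, ‖∫ l, PoissonH (u - l) ε ∂μs‖ₑ := lintegral_add_right' _ hmeas
    _ ≤ _ := add_le_add (setLIntegral_le_lintegral _ _)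
        (setLIntegral_enorm_integral_PoissonH_le μs hU.measurableSet hμsS hδ hε hsep)
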